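/- Let R be a UFD with field of fractions K. For i = 1, 2 let aᵢ, bᵢ ∈ R be nonzero, Aᵢ ∈ R[X], Bᵢ ∈ R[Y] with Aᵢ(0) = Bᵢ(0) = 0, gcd(Aᵢ, aᵢ) = 1 and gcd(Bᵢ, bᵢ) = 1. Set Fᵢ = (X, Y + Aᵢ(X)/aᵢ) and Gᵢ = (X + Bᵢ(Y)/bᵢ, Y), and let F = G₂∘F₂∘G₁∘F₁ (composition of polynomial maps over K, applying F₁ first). If F ∈ Aut₂(R), then: (i) there exists C ∈ R[X] with A₂(X) = C(b₁X); (ii) there exists D ∈ R[Y] with B₁(Y) = D(a₂Y); (iii) gcd(a₂, b₁) = 1, i.e. every common divisor of a₂ and b₁ in R is a unit. -/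

import Mathlib

noncomputable section

/-- A polynomial map `(P(X,Y), Q(X,Y))` of the plane, given by a pair of polynomials. -/
abbrev PolyPair (K : Type*) [CommSemiring K] :=
  MvPolynomial (Fin 2) K × MvPolynomial (Fin 2) K

/-- Composition of polynomial maps: `pcomp G F = G ∘ F` (the map `F` is applied first). -/
def pcomp {K : Type*} [CommSemiring K] (G F : PolyPair K) : PolyPair K :=
  (MvPolynomial.aeval ![F.1, F.2] G.1, MvPolynomial.aeval ![F.1, F.2] G.2)

/-- The identity polynomial map `(X, Y)`. -/
def idPair (K : Type*) [CommSemiring K] : PolyPair K :=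
  (MvPolynomial.X 0, MvPolynomial.X 1)

/-- All coefficients of `p` lie in (the image of) `R`. -/
def CoeffsIn (R : Type*) {K : Type*} [CommSemiring R] [CommSemiring K] [Algebra R K]
    (p : MvPolynomial (Fin 2) K) : Prop :=
  ∀ m : Fin 2 →₀ ℕ, p.coeff m ∈ Set.range (algebraMap R K)

/-- `F ∈ Aut₂(R)`: the polynomial map `F` over `K` is invertible (hence corresponds to an
automorphism over `K`) and both coordinate polynomials of `F` and of its inverse have all
of their coefficients in `R`. -/
def MemAut2 (R : Type*) {K : Type*} [CommSemiring R] [CommSemiring K] [Algebra R K]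
    (F : PolyPair K) : Prop :=
  CoeffsIn R F.1 ∧ CoeffsIn R F.2 ∧
    ∃ G : PolyPair K, CoeffsIn R G.1 ∧ CoeffsIn R G.2 ∧
      pcomp F G = idPair K ∧ pcomp G F = idPair K

/-- The elementary polynomial map `(X, Y + p(X))`. -/
def elemF {K : Type*} [CommSemiring K] (p : Polynomial K) : PolyPair K :=
  (MvPolynomial.X 0, MvPolynomial.X 1 + Polynomial.aeval (MvPolynomial.X 0) p)

/-- The elementary polynomial map `(X + p(Y), Y)`. -/
def elemG {K : Type*} [CommSemiring K] (p : Polynomial K) : PolyPair K :=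
  (MvPolynomial.X 0 + Polynomial.aeval (MvPolynomial.X 1) p, MvPolynomial.X 1)

end

noncomputable section

open Polynomial in
/-- If no prime divisor of `m` divides the polynomial `B` without constant term, then
substituting `B` does not create divisibility by `m`. -/
lemma C_dvd_of_C_dvd_comp {R : Type*} [CommRing R] [IsDomain R] [UniqueFactorizationMonoid R]
    (B : R[X]) (hB0 : B.eval 0 = 0) (m : R) (hm : m ≠ 0)
    (hmB : ∀ p : R, Prime p → p ∣ m → ¬ C p ∣ B) (Q : R[X]) (h : C m ∣ Q.comp B) :
    C m ∣ Q := by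
  induction m using UniqueFactorizationMonoid.induction_on_prime generalizing Q with
  | h₁ => exact absurd rfl hm
  | h₂ x hx => exact (hx.map C).dvd
  | h₃ a p ha hp ih =>
    have hpQ : C p ∣ Q := by
      have hprime : (Ideal.span {p}).IsPrime :=
        (Ideal.span_singleton_prime hp.ne_zero).2 hp
      have key : ∀ P : R[X], C p ∣ P ↔ P.map (Ideal.Quotient.mk (Ideal.span {p})) = 0 := by
        intro P
        rw [C_dvd_iff_dvd_coeff, Polynomial.ext_iff]
        simp [Ideal.Quotient.eq_zero_iff_mem, Ideal.mem_span_singleton]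
      have h1 : C p ∣ Q.comp B := (map_dvd C (dvd_mul_right p a)).trans h
      have h2 := hmB p hp (dvd_mul_right p a)
      rw [key] at h1 h2 ⊢
      rw [map_comp, comp_eq_zero_iff] at h1
      rcases h1 with h1 | ⟨-, h1⟩
      · exact h1
      · refine absurd ?_ h2
        rw [h1, coeff_map, coeff_zero_eq_eval_zero, hB0, map_zero, map_zero]
    obtain ⟨Q', rfl⟩ := hpQ
    rw [mul_comp, C_comp, C_mul] at h
    rw [C_mul]
    have hp0 : (C p : R[X]) ≠ 0 := C_ne_zero.2 hp.ne_zero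
    exact mul_dvd_mul_left _ (ih ha (fun q hq hqa => hmB q hq (hqa.mul_left p)) _
      ((mul_dvd_mul_iff_left hp0).1 h))

open Polynomial in
/-- If `A(B/b)` is `a` times a polynomial over `R`, where `B` is prime to `b` and has no constant
term, then `A(X) = d C(bX)` for every common divisor `d` of `a` and `b`. -/
lemma exists_eq_C_mul_comp {R : Type*} [CommRing R] [IsDomain R] [UniqueFactorizationMonoid R]
    (K : Type*) [Field K] [Algebra R K] [IsFractionRing R K]
    (a b d : R) (hb : b ≠ 0) (hda : d ∣ a) (hdb : d ∣ b) (A B H : R[X])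
    (hB0 : B.eval 0 = 0) (hgcd : ∀ e : R[X], e ∣ B → e ∣ C b → IsUnit e)
    (h : (A.map (algebraMap R K)).comp (C (algebraMap R K b)⁻¹ * B.map (algebraMap R K)) =
      C (algebraMap R K a) * H.map (algebraMap R K)) :
    ∃ D : R[X], A = C d * D.comp (C b * X) := by
  have hinj : Function.Injective (algebraMap R K) := IsFractionRing.injective R K
  have hbK : algebraMap R K b ≠ 0 := (map_ne_zero_iff _ hinj).2 hb
  set n := A.natDegree with hn
  set Q : R[X] := ∑ k ∈ Finset.range (n + 1), C (A.coeff k * b ^ (n - k)) * X ^ k with hQ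
  have hQB : Q.comp B = C (b ^ n * a) * H := by
    apply map_injective _ hinj
    rw [Polynomial.map_mul, map_C, map_mul, C_mul, mul_assoc, ← h, A.as_sum_range_C_mul_X_pow,
      ← hn, hQ]
    simp only [Polynomial.map_sum, Polynomial.sum_comp, Finset.mul_sum]
    refine Finset.sum_congr rfl fun k hk => ?_
    have hkn : k ≤ n := Nat.lt_succ_iff.1 (Finset.mem_range.1 hk)
    simp only [mul_comp, C_comp, pow_comp, X_comp, Polynomial.map_mul, Polynomial.map_pow, map_C,
      map_X, map_mul, map_pow, mul_pow]
    have hc : (C (algebraMap R K b) : K[X]) ^ n * C (algebraMap R K b)⁻¹ ^ k =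
        C (algebraMap R K b) ^ (n - k) := by
      rw [← C_pow, ← C_pow, ← C_pow, ← C_mul]
      congr 1
      rw [inv_pow, ← div_eq_mul_inv, pow_sub₀ _ hbK hkn, div_eq_mul_inv]
    rw [← hc]
    ring
  have hdvd : C (b ^ n * d) ∣ Q := by
    have hd : d ≠ 0 := fun h0 => hb (zero_dvd_iff.1 (h0 ▸ hdb))
    refine C_dvd_of_C_dvd_comp B hB0 _ (mul_ne_zero (pow_ne_zero _ hb) hd) ?_ Q ?_
    · intro p hp hpm hpB
      have hpb : p ∣ b := by
        rcases hp.dvd_or_dvd hpm with h1 | h1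
        · exact hp.dvd_of_dvd_pow h1
        · exact h1.trans hdb
      exact hp.not_isUnit (isUnit_C.1 (hgcd _ hpB (map_dvd C hpb)))
    · rw [hQB]
      exact (map_dvd C (mul_dvd_mul_left _ hda)).mul_right _
  have hcoeff : ∀ k, k ≤ n → ∃ c, A.coeff k = d * (c * b ^ k) := by
    intro k hk
    obtain ⟨c, hc⟩ := C_dvd_iff_dvd_coeff _ _ |>.1 hdvd k
    have hQk : Q.coeff k = A.coeff k * b ^ (n - k) := by
      simp only [hQ, finsetSum_coeff, coeff_C_mul_X_pow, Finset.sum_ite_eq, Finset.mem_range,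
        Nat.lt_succ_iff, hk, if_true]
    refine ⟨c, mul_right_cancel₀ (pow_ne_zero (n - k) hb) ?_⟩
    rw [← hQk, hc]
    nth_rewrite 1 [← Nat.add_sub_of_le hk]
    ring
  choose! c hc using hcoeff
  refine ⟨∑ k ∈ Finset.range (n + 1), C (c k) * X ^ k, ?_⟩
  conv_lhs => rw [A.as_sum_range_C_mul_X_pow, ← hn]
  simp only [Polynomial.sum_comp, Finset.mul_sum]
  refine Finset.sum_congr rfl fun k hk => ?_
  rw [hc k (Nat.lt_succ_iff.1 (Finset.mem_range.1 hk))]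
  simp only [mul_comp, C_comp, pow_comp, X_comp, C_mul, C_pow]
  ring

/-- Substituting polynomials over `R` into a polynomial with coefficients in `R` gives a
polynomial over `R`. -/
lemma CoeffsIn.exists_map_eq_aeval {R K : Type*} [CommRing R] [CommRing K] [Algebra R K]
    {p : MvPolynomial (Fin 2) K} (hp : CoeffsIn R p) (f : Fin 2 → Polynomial R) :
    ∃ H : Polynomial R, H.map (algebraMap R K) =
      MvPolynomial.aeval (fun i => (f i).map (algebraMap R K)) p := by
  have hmem : p ∈ Set.range (MvPolynomial.map (σ := Fin 2) (algebraMap R K)) := by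
    rw [MvPolynomial.mem_range_map_iff_coeffs_subset]
    intro x hx
    obtain ⟨m, -, rfl⟩ := MvPolynomial.mem_coeffs_iff.1 hx
    exact hp m
  obtain ⟨q, rfl⟩ := hmem
  clear hp
  refine ⟨MvPolynomial.aeval f q, ?_⟩
  induction q using MvPolynomial.induction_on with
  | C r => simp
  | add p q hp hq => simp_all
  | mul_X p i hp => simp_all

section

variable {K S : Type*} [CommRing K] [CommRing S] [Algebra K S]

lemma map_pcomp_fst (ψ : MvPolynomial (Fin 2) K →ₐ[K] S) (G F : PolyPair K) :
    ψ (pcomp G F).1 = MvPolynomial.aeval ![ψ F.1, ψ F.2] G.1 := by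
  rw [pcomp, ← AlgHom.comp_apply, MvPolynomial.comp_aeval]
  congr 2
  ext i
  fin_cases i <;> rfl

lemma map_pcomp_snd (ψ : MvPolynomial (Fin 2) K →ₐ[K] S) (G F : PolyPair K) :
    ψ (pcomp G F).2 = MvPolynomial.aeval ![ψ F.1, ψ F.2] G.2 :=
  map_pcomp_fst ψ (G.2, G.1) F

lemma aeval_elemF_fst (p : Polynomial K) (u v : S) :
    MvPolynomial.aeval ![u, v] (elemF p).1 = u := by
  simp [elemF]

lemma aeval_elemF_snd (p : Polynomial K) (u v : S) :
    MvPolynomial.aeval ![u, v] (elemF p).2 = v + Polynomial.aeval u p := by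
  simp [elemF, ← Polynomial.aeval_algHom_apply]

lemma aeval_elemG_fst (p : Polynomial K) (u v : S) :
    MvPolynomial.aeval ![u, v] (elemG p).1 = u + Polynomial.aeval v p := by
  simp [elemG, ← Polynomial.aeval_algHom_apply]

lemma aeval_elemG_snd (p : Polynomial K) (u v : S) :
    MvPolynomial.aeval ![u, v] (elemG p).2 = v := by
  simp [elemG]

end

open Polynomial in
/-- If `G₂ ∘ F₂ ∘ G₁ ∘ F₁` is an automorphism over `R`, where the factors are elementary with
polynomials `δ`, `γ`, `β`, `α`, then `γ(β(X))` and `β(-γ(X))` have coefficients in `R`. -/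
lemma MemAut2.exists_map_eq_comp {R K : Type*} [CommRing R] [CommRing K] [Algebra R K]
    {α β γ δ : K[X]} (hα : α.eval 0 = 0) (hδ : δ.eval 0 = 0)
    (h : MemAut2 R (pcomp (elemG δ) (pcomp (elemF γ) (pcomp (elemG β) (elemF α))))) :
    (∃ H : R[X], γ.comp β = H.map (algebraMap R K)) ∧
      ∃ H : R[X], β.comp (-γ) = H.map (algebraMap R K) := by
  obtain ⟨-, h2, G, hG1, -, hFG, -⟩ := h
  constructor
  · obtain ⟨H, hH⟩ := h2.exists_map_eq_aeval ![0, X]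
    have hv : (fun i => ((![0, X] : Fin 2 → R[X]) i).map (algebraMap R K)) = ![0, X] := by
      ext1 i
      fin_cases i <;> simp
    have hα' : aeval (0 : K[X]) α = 0 := by
      rw [← comp_eq_aeval, comp_zero, hα, C_0]
    rw [hv] at hH
    simp only [map_pcomp_fst, map_pcomp_snd, aeval_elemF_fst, aeval_elemF_snd, aeval_elemG_fst,
      aeval_elemG_snd, hα', add_zero, zero_add] at hH
    refine ⟨H - X, ?_⟩
    rw [Polynomial.map_sub, hH, map_X, ← comp_eq_aeval, ← comp_eq_aeval, comp_X,
      add_sub_cancel_left]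
  · obtain ⟨H, hH⟩ := hG1.exists_map_eq_aeval ![X, 0]
    have hv : (fun i => ((![X, 0] : Fin 2 → R[X]) i).map (algebraMap R K)) = ![X, 0] := by
      ext1 i
      fin_cases i <;> simp
    rw [hv] at hH
    have e1 := congrArg (MvPolynomial.aeval ![(X : K[X]), 0]) (congrArg Prod.fst hFG)
    have e2 := congrArg (MvPolynomial.aeval ![(X : K[X]), 0]) (congrArg Prod.snd hFG)
    simp only [map_pcomp_fst, map_pcomp_snd, aeval_elemF_fst, aeval_elemF_snd, aeval_elemG_fst,
      aeval_elemG_snd, ← hH] at e1 e2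
    generalize MvPolynomial.aeval ![(X : K[X]), 0] G.2 = v at e1 e2
    generalize v + aeval (H.map (algebraMap R K)) α = y at e1 e2
    generalize hx : H.map (algebraMap R K) + aeval y β = x at e1 e2
    have e2' : y + aeval x γ = 0 := by simpa [idPair] using e2
    have hδ' : aeval (0 : K[X]) δ = 0 := by
      rw [← comp_eq_aeval, comp_zero, hδ, C_0]
    have e1' : x = X := by simpa [idPair, e2', hδ'] using e1
    subst e1'
    have hy : y = -γ := by
      rw [← comp_eq_aeval, comp_X] at e2'
      exact eq_neg_of_add_eq_zero_left e2'
    refine ⟨X - H, ?_⟩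
    rw [Polynomial.map_sub, map_X, ← hx, add_sub_cancel_left, hy, comp_eq_aeval]

/-- Let `R` be a UFD with fraction field `K`. For `i = 1, 2` let
`aᵢ, bᵢ ∈ R` be nonzero, `Aᵢ ∈ R[X]`, `Bᵢ ∈ R[Y]` with `Aᵢ(0) = Bᵢ(0) = 0`,
`gcd(Aᵢ, aᵢ) = 1` and `gcd(Bᵢ, bᵢ) = 1`. Set `Fᵢ = (X, Y + Aᵢ(X)/aᵢ)`,
`Gᵢ = (X + Bᵢ(Y)/bᵢ, Y)` and `F = G₂∘F₂∘G₁∘F₁`. If `F ∈ Aut₂(R)` then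
(i) `A₂(X) = C(b₁X)` for some `C ∈ R[X]`; (ii) `B₁(Y) = D(a₂Y)` for some
`D ∈ R[Y]`; (iii) `gcd(a₂, b₁) = 1`. -/
theorem stmt_3 {R : Type*} [CommRing R] [IsDomain R] [UniqueFactorizationMonoid R]
    (a₁ a₂ b₁ b₂ : R) (ha₁ : a₁ ≠ 0) (ha₂ : a₂ ≠ 0) (hb₁ : b₁ ≠ 0) (hb₂ : b₂ ≠ 0)
    (A₁ A₂ B₁ B₂ : Polynomial R)
    (hA₁0 : Polynomial.eval 0 A₁ = 0) (hA₂0 : Polynomial.eval 0 A₂ = 0)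
    (hB₁0 : Polynomial.eval 0 B₁ = 0) (hB₂0 : Polynomial.eval 0 B₂ = 0)
    (hgcdA₁ : ∀ d : Polynomial R, d ∣ A₁ → d ∣ Polynomial.C a₁ → IsUnit d)
    (hgcdA₂ : ∀ d : Polynomial R, d ∣ A₂ → d ∣ Polynomial.C a₂ → IsUnit d)
    (hgcdB₁ : ∀ d : Polynomial R, d ∣ B₁ → d ∣ Polynomial.C b₁ → IsUnit d)
    (hgcdB₂ : ∀ d : Polynomial R, d ∣ B₂ → d ∣ Polynomial.C b₂ → IsUnit d)
    (hF : MemAut2 R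
      (pcomp
        (elemG (Polynomial.C ((algebraMap R (FractionRing R)) b₂)⁻¹ *
          B₂.map (algebraMap R (FractionRing R))))
        (pcomp
          (elemF (Polynomial.C ((algebraMap R (FractionRing R)) a₂)⁻¹ *
            A₂.map (algebraMap R (FractionRing R))))
          (pcomp
            (elemG (Polynomial.C ((algebraMap R (FractionRing R)) b₁)⁻¹ *
              B₁.map (algebraMap R (FractionRing R))))
            (elemF (Polynomial.C ((algebraMap R (FractionRing R)) a₁)⁻¹ *
              A₁.map (algebraMap R (FractionRing R)))))))) :
    (∃ C : Polynomial R, A₂ = C.comp (Polynomial.C b₁ * Polynomial.X)) ∧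
    (∃ D : Polynomial R, B₁ = D.comp (Polynomial.C a₂ * Polynomial.X)) ∧
    (∀ d : R, d ∣ a₂ → d ∣ b₁ → IsUnit d) := by
  open Polynomial in
  set K := FractionRing R
  have hK : ∀ r : R, r ≠ 0 → algebraMap R K r ≠ 0 := fun r hr =>
    (map_ne_zero_iff _ (IsFractionRing.injective R K)).2 hr
  have h0 : ∀ (r : K) (P : R[X]), P.eval 0 = 0 →
      (C r * P.map (algebraMap R K)).eval 0 = 0 := by
    intro r P hP
    rw [eval_mul, eval_zero_map, hP, map_zero, mul_zero]
  obtain ⟨⟨H₁, h₁⟩, H₂, h₂⟩ := hF.exists_map_eq_comp (h0 _ _ hA₁0) (h0 _ _ hB₂0)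
  have clear_denom : ∀ (r : R) (P : R[X]) (S T : K[X]), r ≠ 0 →
      (C (algebraMap R K r)⁻¹ * P.map (algebraMap R K)).comp S = T →
      (P.map (algebraMap R K)).comp S = C (algebraMap R K r) * T := by
    rintro r P S _ hr rfl
    rw [mul_comp, C_comp, ← mul_assoc, ← C_mul, mul_inv_cancel₀ (hK r hr), C_1, one_mul]
  have k₁ := clear_denom _ _ _ _ ha₂ h₁
  have k₂ := clear_denom _ _ _ _ hb₁ h₂
  rw [← mul_neg, ← Polynomial.map_neg] at k₂
  refine ⟨?_, ?_, ?_⟩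
  · simpa using exists_eq_C_mul_comp K a₂ b₁ 1 hb₁ (one_dvd _) (one_dvd _) A₂ B₁ H₁ hB₁0
      hgcdB₁ k₁
  · simpa using exists_eq_C_mul_comp K b₁ a₂ 1 ha₂ (one_dvd _) (one_dvd _) B₁ (-A₂) H₂
      (by rw [eval_neg, hA₂0, neg_zero]) (fun e he => hgcdA₂ e ((dvd_neg).1 he)) k₂
  · intro d hda hdb
    obtain ⟨D, hD⟩ := exists_eq_C_mul_comp K a₂ b₁ d hb₁ hda hdb A₂ B₁ H₁ hB₁0 hgcdB₁ k₁
    exact isUnit_C.1 (hgcdA₂ _ (Dvd.intro _ hD.symm) (map_dvd C hda))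

end
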